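/- Let (Σ) be given by f_1,…,f_r quasi-regular at 𝔓 satisfying the standing rank hypothesis, and let 𝓔 = (ε_{ij}) with ε_{ij} = ord_{X_j}(f_i) and ε_{ij} = −∞ if X_j does not appear in f_i. Then for every integer k with k ≥ e − min{ε_{ij} : ε_{ij} ≠ −∞}, the rank over 𝕂 of the pseudo-Jacobian matrix 𝔍_k := 𝔍_{k,e−1} satisfies rank(𝔍_k) ≤ max over injections τ:{1,…,r}→{1,…,n} of Σ_{i=1}^r max{0, k − e + ε_{iτ(i)}}, where max{0, k−e+(−∞)} := 0. -/

import Mathlib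

set_option synthInstance.maxHeartbeats 1000000
set_option maxHeartbeats 4000000

noncomputable section

namespace DAE

open MvPolynomial

/-- The ring of differential polynomials `K{X_1,…,X_n}`: the polynomial ring in the
variables `X_j^{(l)}`, `1 ≤ j ≤ n`, `l ∈ ℕ`. -/
abbrev DP (K : Type) [Field K] (n : ℕ) : Type := MvPolynomial (Fin n × ℕ) K

variable {K : Type} [Field K] {n : ℕ}

/-- `δ : K → K` is a derivation of the field `K`. -/
structure IsDeriv (K : Type) [Field K] (δ : K → K) : Prop where
  map_add : ∀ a b, δ (a + b) = δ a + δ b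
  leibniz : ∀ a b, δ (a * b) = a * δ b + b * δ a

/-- `D` is the total derivation of `K{X}` extending the derivation `δ` of `K`, with
`D X_j^{(l)} = X_j^{(l+1)}`. The `p`-th total derivative of `g` is `D^[p] g`. -/
structure IsTotalDeriv (K : Type) [Field K] (n : ℕ) (δ : K → K) (D : DP K n → DP K n) : Prop where
  map_add : ∀ f g, D (f + g) = D f + D g
  leibniz : ∀ f g, D (f * g) = f * D g + g * D f
  map_C : ∀ a : K, D (C a) = C (δ a)
  map_X : ∀ (j : Fin n) (l : ℕ), D (X (j, l)) = X (j, l + 1)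

/-- the maximal order of derivation of `X_j` appearing in `f` (`0` when absent) -/
def ordIn (f : DP K n) (j : Fin n) : ℕ :=
  (f.vars.filter fun v => v.1 = j).sup fun v => v.2

/-- some derivative of `X_j` appears in `f` -/
def appearsIn (f : DP K n) (j : Fin n) : Prop :=
  (f.vars.filter fun v => v.1 = j).Nonempty

instance {K : Type} [Field K] {n : ℕ} (f : DP K n) (j : Fin n) : Decidable (appearsIn f j) := by
  unfold appearsIn; infer_instance

/-- the order of `f`: maximal order of derivation of a variable appearing in `f` -/
def ordOf (f : DP K n) : ℕ := f.vars.sup fun v => v.2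

/-- `I` is a differential ideal (stable under the total derivation `D`) -/
def IsDiffIdeal (D : DP K n → DP K n) (I : Ideal (DP K n)) : Prop := ∀ g ∈ I, D g ∈ I

/-- the differential ideal `[f_1,…,f_r]` generated by `f_1,…,f_r` -/
def diffIdealGen (D : DP K n → DP K n) {r : ℕ} (f : Fin r → DP K n) : Ideal (DP K n) :=
  sInf {I | (∀ t, f t ∈ I) ∧ IsDiffIdeal D I}

/-- `𝔓` is a prime differential ideal, minimal among those containing `f_1,…,f_r` -/
def IsMinimalPrimeDiff (D : DP K n → DP K n) {r : ℕ} (f : Fin r → DP K n)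
    (𝔓 : Ideal (DP K n)) : Prop :=
  𝔓.IsPrime ∧ IsDiffIdeal D 𝔓 ∧ (∀ t, f t ∈ 𝔓) ∧
    ∀ Q : Ideal (DP K n), Q.IsPrime → IsDiffIdeal D Q → (∀ t, f t ∈ Q) → Q ≤ 𝔓 → Q = 𝔓

/-- the polynomial ring `A_i := K[X^{[i]}]` -/
abbrev AP (K : Type) [Field K] (n i : ℕ) : Type := MvPolynomial (Fin n × Fin (i + 1)) K

/-- the inclusion `A_i ↪ K{X}` -/
def inclA (K : Type) [Field K] (n i : ℕ) : AP K n i →+* DP K n :=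
  (rename fun v : Fin n × Fin (i + 1) => ((v.1, (v.2 : ℕ)) : Fin n × ℕ)).toRingHom

/-- the truncation `K{X} → A_i` (a retraction of `inclA`, exact on polynomials of
order at most `i`) -/
def truncA (K : Type) [Field K] (n i : ℕ) : DP K n →+* AP K n i :=
  (aeval fun v : Fin n × ℕ =>
    if h : v.2 < i + 1 then (X (v.1, ⟨v.2, h⟩) : AP K n i) else 0).toRingHom

/-- the contraction `A_i ∩ 𝔓` -/
def Pc {K : Type} [Field K] {n : ℕ} (i : ℕ) (𝔓 : Ideal (DP K n)) : Ideal (AP K n i) :=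
  𝔓.comap (inclA K n i)

instance {K : Type} [Field K] {n : ℕ} (i : ℕ) (𝔓 : Ideal (DP K n)) [𝔓.IsPrime] :
    (Pc i 𝔓).IsPrime := Ideal.IsPrime.comap _

/-- the local ring `B_i`: the localization of `A_i` at the prime `A_i ∩ 𝔓` -/
abbrev BL (K : Type) [Field K] (n : ℕ) (i : ℕ) (𝔓 : Ideal (DP K n)) [𝔓.IsPrime] : Type :=
  Localization.AtPrime (Pc (K := K) (n := n) i 𝔓)

/-- the transition map `A_i → A_{i'}` for `i ≤ i'` -/
def renAA (K : Type) [Field K] (n : ℕ) {i i' : ℕ} (h : i ≤ i') : AP K n i →+* AP K n i' :=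
  (rename (Prod.map (id : Fin n → Fin n) (Fin.castLE (by omega)))).toRingHom

lemma inclA_comp_renAA (K : Type) [Field K] (n : ℕ) {i i' : ℕ} (h : i ≤ i') :
    (inclA K n i').comp (renAA K n h) = inclA K n i := by
  ext p
  · simp [inclA, renAA]
  · simp [inclA, renAA]

lemma Pc_eq_comap {K : Type} [Field K] {n : ℕ} (𝔓 : Ideal (DP K n)) {i i' : ℕ} (h : i ≤ i') :
    Pc i 𝔓 = (Pc i' 𝔓).comap (renAA K n h) := by
  unfold Pc
  rw [Ideal.comap_comap, inclA_comp_renAA]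

/-- the canonical local map `B_i → B_{i'}`, `i ≤ i'` -/
def ringBB {K : Type} [Field K] {n : ℕ} (𝔓 : Ideal (DP K n)) [𝔓.IsPrime] {i i' : ℕ}
    (h : i ≤ i') : BL K n i 𝔓 →+* BL K n i' 𝔓 :=
  Localization.localRingHom _ _ (renAA K n h) (Pc_eq_comap 𝔓 h)

/-- the canonical local map `B_i → K{X}_𝔓` -/
def ringBP {K : Type} [Field K] {n : ℕ} (𝔓 : Ideal (DP K n)) [𝔓.IsPrime] (i : ℕ) :
    BL K n i 𝔓 →+* Localization.AtPrime 𝔓 :=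
  Localization.localRingHom _ _ (inclA K n i) rfl

/-- the image in `B_j` of a differential polynomial (of order `≤ j`) -/
def bElem {K : Type} [Field K] {n : ℕ} (𝔓 : Ideal (DP K n)) [𝔓.IsPrime] (j : ℕ)
    (g : DP K n) : BL K n j 𝔓 :=
  algebraMap (AP K n j) (BL K n j 𝔓) (truncA K n j g)

/-- the prolongation ideal `Δ_m = (f_1^{[m-1]},…,f_r^{[m-1]})` in the ring `B_j` -/
def prolong (D : DP K n → DP K n) {r : ℕ} (f : Fin r → DP K n)
    (𝔓 : Ideal (DP K n)) [𝔓.IsPrime] (m j : ℕ) : Ideal (BL K n j 𝔓) :=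
  Ideal.span {x | ∃ (t : Fin r) (s : ℕ) (a : AP K n j),
    s < m ∧ inclA K n j a = D^[s] (f t) ∧ x = algebraMap (AP K n j) (BL K n j 𝔓) a}

/-- `Δ := 𝔓·K{X}_𝔓` -/
def bigDelta {K : Type} [Field K] {n : ℕ} (𝔓 : Ideal (DP K n)) [𝔓.IsPrime] :
    Ideal (Localization.AtPrime 𝔓) :=
  Ideal.map (algebraMap (DP K n) (Localization.AtPrime 𝔓)) 𝔓

instance {K : Type} [Field K] {n : ℕ} (𝔓 : Ideal (DP K n)) [𝔓.IsPrime] :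
    IsDomain (DP K n ⧸ 𝔓) := Ideal.Quotient.isDomain 𝔓

/-- `𝕂 := Frac(K{X}/𝔓)`, the residual field of `𝔓` -/
abbrev KK (K : Type) [Field K] (n : ℕ) (𝔓 : Ideal (DP K n)) [𝔓.IsPrime] : Type :=
  FractionRing (DP K n ⧸ 𝔓)

/-- the canonical map `K{X} → 𝕂` -/
def toKK {K : Type} [Field K] {n : ℕ} (𝔓 : Ideal (DP K n)) [𝔓.IsPrime] :
    DP K n →+* KK K n 𝔓 :=
  (algebraMap (DP K n ⧸ 𝔓) (KK K n 𝔓)).comp (Ideal.Quotient.mk 𝔓)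

/-- the Jacobian matrix of `f_1^{[i-1]},…,f_r^{[i-1]}` with respect to `X^{[i-1+e]}`,
with entries taken in `𝕂` (full row rank over the domain `A_{i-1+e}/(A_{i-1+e}∩𝔓)` is
equivalent to full rank over its fraction field, hence over `𝕂`). -/
def qrJac (D : DP K n → DP K n) {r : ℕ} (f : Fin r → DP K n)
    (𝔓 : Ideal (DP K n)) [𝔓.IsPrime] (e i : ℕ) :
    Matrix (Fin r × Fin i) (Fin n × Fin (i + e)) (KK K n 𝔓) :=
  fun p q => toKK 𝔓 (pderiv (q.1, (q.2 : ℕ)) (D^[(p.2 : ℕ)] (f p.1)))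

/-- the system `f_1,…,f_r` is quasi-regular at `𝔓` -/
def IsQuasiRegularAt (D : DP K n → DP K n) {r : ℕ} (f : Fin r → DP K n)
    (𝔓 : Ideal (DP K n)) [𝔓.IsPrime] (e : ℕ) : Prop :=
  ∀ i : ℕ, 1 ≤ i → (qrJac D f 𝔓 e i).rank = r * i

/-- the entry of the pseudo-Jacobian `𝔍_{k,i}` in block `(p,q)`, row `t := p.2`,
column `j := q.2`: `∂ f_t^{(i-e+1+p)} / ∂ X_j^{(i+1+q)}` -/
def jEntry (D : DP K n → DP K n) {r : ℕ} (f : Fin r → DP K n) (e i : ℕ) {k : ℕ}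
    (p : Fin k × Fin r) (q : Fin k × Fin n) : DP K n :=
  pderiv (q.2, i + 1 + (q.1 : ℕ)) (D^[i + 1 - e + (p.1 : ℕ)] (f p.2))

/-- the pseudo-Jacobian `𝔍_{k,i}` over `𝕂` -/
def Jmat (D : DP K n → DP K n) {r : ℕ} (f : Fin r → DP K n)
    (𝔓 : Ideal (DP K n)) [𝔓.IsPrime] (e k i : ℕ) :
    Matrix (Fin k × Fin r) (Fin k × Fin n) (KK K n 𝔓) :=
  fun p q => toKK 𝔓 (jEntry D f e i p q)

/-- `μ_{k,i} := kr − rank_𝕂 𝔍_{k,i}` -/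
def mu (D : DP K n → DP K n) {r : ℕ} (f : Fin r → DP K n)
    (𝔓 : Ideal (DP K n)) [𝔓.IsPrime] (e k i : ℕ) : ℕ :=
  k * r - (Jmat D f 𝔓 e k i).rank

/-- the pseudo-Jacobian `𝔍_{k,i}` over the ring `B_j / Δ_m` -/
def JmatOver (D : DP K n → DP K n) {r : ℕ} (f : Fin r → DP K n)
    (𝔓 : Ideal (DP K n)) [𝔓.IsPrime] (e k i m j : ℕ) :
    Matrix (Fin k × Fin r) (Fin k × Fin n) (BL K n j 𝔓 ⧸ prolong D f 𝔓 m j) :=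
  fun p q => Ideal.Quotient.mk _ (bElem 𝔓 j (jEntry D f e i p q))

/-- the standing rank hypothesis: for every `k,i` the rank of `𝔍_{k,i}` over the
domain `B_{i+k+s}/Δ_{i-1+e+k+s}` does not depend on `s` and equals its rank over `𝕂` -/
def StandingRank (D : DP K n → DP K n) {r : ℕ} (f : Fin r → DP K n)
    (𝔓 : Ideal (DP K n)) [𝔓.IsPrime] (e : ℕ) : Prop :=
  ∀ k i s : ℕ, 1 ≤ k → e - 1 ≤ i →
    (JmatOver D f 𝔓 e k i (i - 1 + e + k + s) (i + k + s)).rank = (Jmat D f 𝔓 e k i).rank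

/-- the Jacobi number of a matrix of natural numbers -/
def jacobiN {ι κ : Type} [Fintype ι] [Fintype κ] [DecidableEq ι] [DecidableEq κ]
    (M : ι → κ → ℕ) : ℕ :=
  Finset.univ.sup fun τ : {τ : ι → κ // Function.Injective τ} => ∑ i, M i (τ.1 i)

/-- the Jacobi number of a matrix with entries in `ℕ₀ ∪ {−∞}` -/
def jacobiE {ι κ : Type} [Fintype ι] [Fintype κ] [DecidableEq ι] [DecidableEq κ]
    (M : ι → κ → WithBot ℕ) : WithBot ℕ :=
  Finset.univ.sup fun τ : {τ : ι → κ // Function.Injective τ} => ∑ i, M i (τ.1 i)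

/-- the (finite) transcendence degree of `E` over `F` equals `d` -/
def HasTrdeg (F E : Type) [CommRing F] [CommRing E] [Algebra F E] (d : ℕ) : Prop :=
  ∃ s : Finset E, IsTranscendenceBasis F (fun x : {x : E // x ∈ s} => x.1) ∧ s.card = d

end DAE

namespace DAE

open MvPolynomial

lemma egervary {ι κ : Type} [Fintype ι] [Fintype κ] [DecidableEq ι] [DecidableEq κ]
    (hc : Fintype.card ι = Fintype.card κ) (w : ι → κ → ℕ) :
    ∃ (u : ι → ℕ) (v : κ → ℕ) (τ : ι → κ), Function.Injective τ ∧
      (∀ i j, w i j ≤ u i + v j) ∧ ∑ i, u i + ∑ j, v j = ∑ i, w i (τ i) := by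
  classical
  have hex : ∃ N : ℕ, ∃ (u : ι → ℕ) (v : κ → ℕ), (∀ i j, w i j ≤ u i + v j) ∧
      ∑ i, u i + ∑ j, v j = N :=
    ⟨_, fun i => ∑ j, w i j, fun _ => 0, fun i j => by
      simpa using Finset.single_le_sum (f := fun j => w i j) (fun _ _ => Nat.zero_le _)
        (Finset.mem_univ j), rfl⟩
  obtain ⟨u, v, huv, hN⟩ := Nat.find_spec hex
  have hmin : ∀ (u' : ι → ℕ) (v' : κ → ℕ), (∀ i j, w i j ≤ u' i + v' j) →
      ∑ i, u i + ∑ j, v j ≤ ∑ i, u' i + ∑ j, v' j := by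
    intro u' v' h
    rw [hN]
    exact Nat.find_min' hex ⟨u', v', h, rfl⟩
  let G : ι → Finset κ := fun i => Finset.univ.filter fun j => w i j = u i + v j
  have hall : ∀ S : Finset ι, S.card ≤ (S.biUnion G).card := by
    intro S
    by_contra hlt
    push Not at hlt
    set T := S.biUnion G with hT
    have hstrict : ∀ i ∈ S, ∀ j, j ∉ T → w i j < u i + v j := by
      intro i hi j hj
      refine lt_of_le_of_ne (huv i j) fun h => hj ?_
      rw [hT, Finset.mem_biUnion]
      exact ⟨i, hi, by simp [G, h]⟩
    by_cases h0 : ∀ i ∈ S, 1 ≤ u i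
    · have := hmin (fun i => if i ∈ S then u i - 1 else u i)
        (fun j => v j + if j ∈ T then 1 else 0) (by
          intro i j
          have h1 := huv i j
          by_cases hi : i ∈ S <;> by_cases hj : j ∈ T <;> simp only [hi, hj, if_true, if_false]
          · have := h0 i hi; omega
          · have := h0 i hi; have := hstrict i hi j hj; omega
          · omega
          · omega)
      have e1 : ∑ i, u i = ∑ i, (if i ∈ S then u i - 1 else u i) + S.card := by
        have : S.card = ∑ i, if i ∈ S then 1 else 0 := by simp
        rw [this, ← Finset.sum_add_distrib]
        refine Finset.sum_congr rfl fun i _ => ?_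
        by_cases hi : i ∈ S
        · have := h0 i hi; simp only [hi, if_true]; omega
        · simp [hi]
      have e2 : ∑ j, (v j + if j ∈ T then 1 else 0) = ∑ j, v j + T.card := by
        rw [Finset.sum_add_distrib]; simp
      omega
    · push Not at h0
      obtain ⟨i0, hi0, hu0⟩ := h0
      have hv : ∀ j, j ∉ T → 1 ≤ v j := by
        intro j hj
        have := hstrict i0 hi0 j hj
        omega
      have := hmin (fun i => u i + if i ∈ S then 0 else 1)
        (fun j => if j ∈ T then v j else v j - 1) (by
          intro i j
          have h1 := huv i j
          by_cases hi : i ∈ S <;> by_cases hj : j ∈ T <;> simp only [hi, hj, if_true, if_false]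
          · omega
          · have := hv j hj; have := hstrict i hi j hj; omega
          · omega
          · have := hv j hj; omega)
      have c1 : (∑ i, if i ∈ S then 0 else 1) + S.card = Fintype.card ι := by
        have : S.card = ∑ i, if i ∈ S then 1 else 0 := by simp
        rw [this, ← Finset.sum_add_distrib, ← Finset.card_univ, Finset.card_eq_sum_ones]
        refine Finset.sum_congr rfl fun i _ => ?_
        split_ifs <;> rfl
      have c2 : (∑ j, if j ∈ T then 0 else 1) + T.card = Fintype.card κ := by
        have : T.card = ∑ i, if i ∈ T then 1 else 0 := by simp
        rw [this, ← Finset.sum_add_distrib, ← Finset.card_univ, Finset.card_eq_sum_ones]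
        refine Finset.sum_congr rfl fun i _ => ?_
        split_ifs <;> rfl
      have e1 : ∑ j, v j = ∑ j, (if j ∈ T then v j else v j - 1) +
          ∑ j, (if j ∈ T then 0 else 1) := by
        rw [← Finset.sum_add_distrib]
        refine Finset.sum_congr rfl fun j _ => ?_
        by_cases hj : j ∈ T
        · simp [hj]
        · have := hv j hj; simp only [hj, if_false]; omega
      have e2 : ∑ i, (u i + if i ∈ S then 0 else 1) =
          ∑ i, u i + ∑ i, (if i ∈ S then 0 else 1) := Finset.sum_add_distrib
      omega
  obtain ⟨τ, hτ, hmem⟩ := (Finset.all_card_le_biUnion_card_iff_exists_injective G).1 hall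
  refine ⟨u, v, τ, hτ, huv, ?_⟩
  have hb : Function.Bijective τ := (Fintype.bijective_iff_injective_and_card τ).2 ⟨hτ, hc⟩
  rw [← hb.sum_comp v, ← Finset.sum_add_distrib]
  refine Finset.sum_congr rfl fun i _ => ?_
  have := hmem i
  simp only [G, Finset.mem_filter] at this
  exact this.2.symm

lemma egervary' {n r : ℕ} (hrn : r ≤ n) (w : Fin r → Fin n → ℕ) :
    ∃ (u : Fin r → ℕ) (v : Fin n → ℕ) (τ : Fin r → Fin n), Function.Injective τ ∧
      (∀ i j, w i j ≤ u i + v j) ∧ ∑ i, u i + ∑ j, v j ≤ ∑ i, w i (τ i) := by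
  obtain ⟨u, v, τ, hτ, h, hs⟩ := egervary (ι := Fin r ⊕ Fin (n - r)) (κ := Fin n)
    (by simp; omega) (Sum.elim w fun _ _ => 0)
  refine ⟨fun i => u (Sum.inl i), v, fun i => τ (Sum.inl i), hτ.comp Sum.inl_injective,
    fun i j => h (Sum.inl i) j, ?_⟩
  simp only [Fintype.sum_sum_type, Sum.elim_inl, Sum.elim_inr, Finset.sum_const_zero] at hs
  simp only
  omega

lemma rank_add_le' {F ι κ : Type} [Field F] [Fintype ι] [Fintype κ]
    (A B : Matrix ι κ F) : (A + B).rank ≤ A.rank + B.rank := by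
  classical
  rw [Matrix.rank, Matrix.rank, Matrix.rank, Matrix.mulVecLin_add]
  refine (Submodule.finrank_mono ?_).trans (Submodule.finrank_add_le_finrank_add_finrank _ _)
  exact LinearMap.range_add_le _ _

lemma rank_le_cover {F ι κ : Type} [Field F] [Fintype ι] [Fintype κ] [DecidableEq ι]
    [DecidableEq κ] (M : Matrix ι κ F) (R : Finset ι) (C : Finset κ)
    (h : ∀ i j, i ∉ R → j ∉ C → M i j = 0) : M.rank ≤ R.card + C.card := by
  classical
  have hM : M = Matrix.diagonal (fun i => if i ∈ R then (1 : F) else 0) * M +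
      (Matrix.of fun i j => if i ∈ R then 0 else M i j) *
        Matrix.diagonal (fun j => if j ∈ C then (1 : F) else 0) := by
    ext i j
    rw [Matrix.add_apply, Matrix.diagonal_mul, Matrix.mul_diagonal]
    by_cases hi : i ∈ R <;> by_cases hj : j ∈ C <;> simp [hi, hj]
    exact h i j hi hj
  rw [hM]
  refine (rank_add_le' _ _).trans (add_le_add ?_ ?_)
  · refine (Matrix.rank_mul_le_left _ _).trans ?_
    rw [Matrix.rank_diagonal, Fintype.card_subtype]
    exact Finset.card_le_card fun i => by simp
  · refine (Matrix.rank_mul_le_right _ _).trans ?_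
    rw [Matrix.rank_diagonal, Fintype.card_subtype]
    exact Finset.card_le_card fun i => by simp

lemma D_supported {K : Type} [Field K] {n : ℕ} {δ : K → K} {D : DP K n → DP K n}
    (hD : IsTotalDeriv K n δ D) {s s' : Set (Fin n × ℕ)} (hs : s ⊆ s')
    (hs' : ∀ v ∈ s, (v.1, v.2 + 1) ∈ s') {g : DP K n} (hg : g ∈ supported K s) :
    D g ∈ supported K s' := by
  have hle : supported K s ≤ supported K s' := supported_mono hs
  have hg' := hg
  rw [supported] at hg'
  induction hg' using Algebra.adjoin_induction with
  | mem x hx =>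
    obtain ⟨⟨j, l⟩, hv, rfl⟩ := hx
    rw [hD.map_X]
    exact Algebra.subset_adjoin ⟨_, hs' _ hv, rfl⟩
  | algebraMap a =>
    change D (C a) ∈ _
    rw [hD.map_C]
    exact (supported K s').algebraMap_mem (δ a)
  | add x y hx hy h1 h2 =>
    rw [hD.map_add]
    exact add_mem (h1 hx) (h2 hy)
  | mul x y hx hy h1 h2 =>
    rw [hD.leibniz]
    exact add_mem (mul_mem (hle hx) (h2 hy)) (mul_mem (hle hy) (h1 hx))

lemma pderiv_iter_eq_zero {K : Type} [Field K] {n : ℕ} {δ : K → K} {D : DP K n → DP K n}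
    (hD : IsTotalDeriv K n δ D) (f : DP K n) (j : Fin n) (p l : ℕ)
    (h : appearsIn f j → ordIn f j + p < l) : pderiv (j, l) (D^[p] f) = 0 := by
  have key : ∀ p, D^[p] f ∈ supported K
      {v : Fin n × ℕ | v.1 = j → appearsIn f j ∧ v.2 ≤ ordIn f j + p} := by
    intro p
    induction p with
    | zero =>
      rw [Function.iterate_zero, id, mem_supported]
      intro v hv hj
      have hm : v ∈ f.vars.filter fun v => v.1 = j := Finset.mem_filter.2 ⟨hv, hj⟩
      exact ⟨⟨v, hm⟩, Finset.le_sup (f := fun v : Fin n × ℕ => v.2) hm⟩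
    | succ p ih =>
      rw [Function.iterate_succ_apply']
      refine D_supported hD ?_ ?_ ih
      · intro v hv hj
        exact ⟨(hv hj).1, by have := (hv hj).2; omega⟩
      · intro v hv hj
        exact ⟨(hv hj).1, by have := (hv hj).2; simp only; omega⟩
  refine pderiv_eq_zero_of_notMem_vars fun hv => ?_
  have := mem_supported.1 (key p) hv rfl
  have h2 := h this.1
  have h3 := this.2
  simp only at h3
  omega

/-- For every `k ≥ e − min{ε_{tj} : ε_{tj} ≠ −∞}`, the rank over `𝕂`
of the pseudo-Jacobian `𝔍_k := 𝔍_{k,e−1}` is bounded by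
`max_τ Σ_t max{0, k − e + ε_{tτ(t)}}`, the maximum being over injections
`τ : {1,…,r} → {1,…,n}` and `max{0, k−e+(−∞)} := 0` (note `max{0, k−e+a} = (k+a)−e`
in truncated natural subtraction). -/
theorem rank_Jmat_le
    {K : Type} [Field K] [CharZero K] {n r : ℕ} (hrn : r ≤ n)
    (δ : K → K) (hδ : IsDeriv K δ)
    (D : DP K n → DP K n) (hD : IsTotalDeriv K n δ D)
    (f : Fin r → DP K n)
    (e : ℕ) (he : e = Finset.univ.sup fun p : Fin r × Fin n => ordIn (f p.1) p.2)
    (he1 : 1 ≤ e)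
    (𝔓 : Ideal (DP K n)) [𝔓.IsPrime]
    (hmin : IsMinimalPrimeDiff D f 𝔓)
    (hqr : IsQuasiRegularAt D f 𝔓 e)
    (hsr : StandingRank D f 𝔓 e)
    (k : ℕ)
    (hk : e - sInf {m : ℕ | ∃ t : Fin r, ∃ j : Fin n,
        appearsIn (f t) j ∧ m = ordIn (f t) j} ≤ k) :
    (Jmat D f 𝔓 e k (e - 1)).rank ≤
      Finset.univ.sup fun τ : {τ : Fin r → Fin n // Function.Injective τ} =>
        ∑ t : Fin r, if appearsIn (f t) (τ.1 t) then k + ordIn (f t) (τ.1 t) - e else 0 := by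
  classical
  set w : Fin r → Fin n → ℕ := fun t j =>
    if appearsIn (f t) j then k + ordIn (f t) j - e else 0 with hw
  obtain ⟨u, v, τ, hτ, huv, hs⟩ := egervary' hrn w
  refine le_trans ?_ (hs.trans (Finset.le_sup (f := fun τ : {τ : Fin r → Fin n //
    Function.Injective τ} => ∑ t : Fin r, w t (τ.1 t)) (Finset.mem_univ ⟨τ, hτ⟩)))
  let R : Finset (Fin k × Fin r) := Finset.univ.filter fun p => k ≤ (p.1 : ℕ) + u p.2
  let S : Finset (Fin k × Fin n) := Finset.univ.filter fun q => (q.1 : ℕ) < v q.2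
  have hR : R.card ≤ ∑ t, u t := by
    have : R.card = ∑ t : Fin r, (R.filter fun p => p.2 = t).card :=
      Finset.card_eq_sum_card_fiberwise fun _ _ => Finset.mem_coe.2 (Finset.mem_univ _)
    rw [this]
    refine Finset.sum_le_sum fun t _ => ?_
    rw [← Finset.card_range (u t)]
    refine Finset.card_le_card_of_injOn (fun p => k - 1 - (p.1 : ℕ)) ?_ ?_
    · rintro ⟨p, t'⟩ hp
      simp only [R, Finset.coe_filter, Finset.mem_filter, Finset.mem_univ, true_and,
        Set.mem_ofPred_eq] at hp
      obtain ⟨h1, rfl⟩ := hp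
      simp only [Finset.coe_range, Set.mem_Iio]
      have := p.2
      omega
    · rintro ⟨p, t'⟩ hp ⟨q, t''⟩ hq hpq
      simp only [R, Finset.coe_filter, Finset.mem_filter, Finset.mem_univ, true_and,
        Set.mem_ofPred_eq] at hp hq hpq
      have h1 := p.2
      have h2 := q.2
      refine Prod.ext (Fin.ext ?_) (hp.2.trans hq.2.symm)
      simp only
      omega
  have hS : S.card ≤ ∑ j, v j := by
    have : S.card = ∑ t : Fin n, (S.filter fun p => p.2 = t).card :=
      Finset.card_eq_sum_card_fiberwise fun _ _ => Finset.mem_coe.2 (Finset.mem_univ _)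
    rw [this]
    refine Finset.sum_le_sum fun t _ => ?_
    rw [← Finset.card_range (v t)]
    refine Finset.card_le_card_of_injOn (fun p => (p.1 : ℕ)) ?_ ?_
    · rintro ⟨p, t'⟩ hp
      simp only [S, Finset.coe_filter, Finset.mem_filter, Finset.mem_univ, true_and,
        Set.mem_ofPred_eq] at hp
      obtain ⟨h1, rfl⟩ := hp
      simpa using h1
    · rintro ⟨p, t'⟩ hp ⟨q, t''⟩ hq hpq
      simp only [S, Finset.coe_filter, Finset.mem_filter, Finset.mem_univ, true_and,
        Set.mem_ofPred_eq] at hp hq hpq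
      exact Prod.ext (Fin.ext hpq) (hp.2.trans hq.2.symm)
  refine (rank_le_cover _ R S ?_).trans (add_le_add hR hS)
  rintro ⟨p, t⟩ ⟨q, j⟩ hp hq
  simp only [R, S, Finset.mem_filter, Finset.mem_univ, true_and, not_le, not_lt] at hp hq
  have : jEntry D f e (e - 1) (p, t) (q, j) = 0 := by
    refine pderiv_iter_eq_zero hD (f t) j _ _ fun ha => ?_
    have h1 := huv t j
    simp only [hw, ha, if_true] at h1
    simp only
    omega
  simp only [Jmat, this, map_zero]

end DAE
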